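/- arXiv:1809.02317 — 2 statements merged into one kernel-verified Lean document; each statement's English description precedes it below -/
import Mathlib

section
/- Let m be a natural number and let g : (Fin m → ℝ) → (Fin m → ℝ) → (Fin m → ℝ) be monotone in each argument with respect to the componentwise order. Let A and B be finite sets of QoS tuples. Then the set of non-dominated elements of { g a b : a ∈ A, b ∈ B } equals the set of non-dominated elements of { g a b : a ∈ Pareto(A), b ∈ B }, where Pareto(A) denotes the set of non-dominated elements of A. -/
/-- `t'` dominates `t` (componentwise order on `Fin m → ℝ`). -/
def Dominates {m : ℕ} (t' t : Fin m → ℝ) : Prop := t ≤ t' ∧ t ≠ t'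

/-- `t` is non-dominated (Pareto optimal) in `S`. -/
def NonDominated {m : ℕ} (S : Set (Fin m → ℝ)) (t : Fin m → ℝ) : Prop :=
  t ∈ S ∧ ∀ t' ∈ S, ¬ Dominates t' t

/-- The Pareto front (set of non-dominated elements) of `S`. -/
def Pareto {m : ℕ} (S : Set (Fin m → ℝ)) : Set (Fin m → ℝ) :=
  {t | NonDominated S t}

theorem pareto_subset {m : ℕ} (S : Set (Fin m → ℝ)) : Pareto S ⊆ S := fun _ ht => ht.1

/-- Every element of a finite set lies below a non-dominated one. -/
theorem exists_le_mem_pareto {m : ℕ} {S : Set (Fin m → ℝ)} (hS : S.Finite) {a : Fin m → ℝ}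
    (ha : a ∈ S) : ∃ a' ∈ Pareto S, a ≤ a' := by
  obtain ⟨a', haa', hmax⟩ := hS.exists_le_maximal ha
  exact ⟨a', ⟨hmax.prop, fun _ ht h => h.2 (hmax.eq_of_le ht h.1)⟩, haa'⟩

/-- Passing to a cofinal subset does not change the Pareto front. -/
theorem pareto_eq_of_cofinal {m : ℕ} {S T : Set (Fin m → ℝ)} (hTS : T ⊆ S)
    (hcof : ∀ s ∈ S, ∃ t ∈ T, s ≤ t) : Pareto S = Pareto T := by
  ext x
  constructor
  · rintro ⟨hx, hmax⟩
    obtain ⟨t, ht, hxt⟩ := hcof x hx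
    have hxt' : x = t := by_contra fun hne => hmax t (hTS ht) ⟨hxt, hne⟩
    exact ⟨hxt' ▸ ht, fun y hy => hmax y (hTS hy)⟩
  · rintro ⟨hx, hmax⟩
    refine ⟨hTS hx, fun s hs ⟨hxs, hne⟩ => ?_⟩
    obtain ⟨t, ht, hst⟩ := hcof s hs
    exact hmax t ht ⟨hxs.trans hst, fun h => hne (hxs.antisymm (h ▸ hst))⟩

theorem stmt_3 {m : ℕ} (g : (Fin m → ℝ) → (Fin m → ℝ) → (Fin m → ℝ))
    (hg1 : ∀ b, Monotone (fun a => g a b)) (hg2 : ∀ a, Monotone (g a))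
    (A B : Finset (Fin m → ℝ)) :
    Pareto (Set.image2 g ↑A ↑B) = Pareto (Set.image2 g (Pareto ↑A) ↑B) := by
  refine pareto_eq_of_cofinal (Set.image2_subset_right (pareto_subset _)) ?_
  rintro _ ⟨a, ha, b, hb, rfl⟩
  obtain ⟨a', ha', haa'⟩ := exists_le_mem_pareto A.finite_toSet ha
  exact ⟨g a' b, Set.mem_image2_of_mem ha' hb, hg1 b haa'⟩
end

section
/- Let m be a natural number, let F ⊆ ℝ^m be an upper set with respect to the componentwise order (i.e., if t ∈ F and t ≤ t' then t' ∈ F), and let S be a finite set of QoS tuples. Then the set of non-dominated elements of S ∩ F equals the set of non-dominated elements of Pareto(S) ∩ F, where Pareto(S) denotes the set of non-dominated elements of S. -/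
theorem stmt_11 {m : ℕ} (F : Set (Fin m → ℝ)) (hF : IsUpperSet F)
    (S : Finset (Fin m → ℝ)) :
    Pareto (↑S ∩ F) = Pareto (Pareto ↑S ∩ F) := by
  ext t
  constructor
  · rintro ⟨⟨htS, htF⟩, hmax⟩
    exact ⟨⟨⟨htS, fun t' ht' hdom => hmax t' ⟨ht', hF hdom.1 htF⟩ hdom⟩, htF⟩,
      fun t' ht' => hmax t' ⟨ht'.1.1, ht'.2⟩⟩
  · rintro ⟨⟨⟨htS, hmax⟩, htF⟩, -⟩
    exact ⟨⟨htS, htF⟩, fun t' ht' => hmax t' ht'.1⟩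
end
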